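/- Non-unitarity for large mass gap (Theorem 2). Let a ∈ {0,1}, let D ≥ 4 be real, and let r, μ be real numbers such that either r > -1 or r is not an integer. If μ > r + 1 and ⌈6μ⌉ is odd, then there exist integers n ≥ 1 with n ≥ 3μ and 0 ≤ j ≤ n-1+a such that B^a_{n,j}(r,μ,D) < 0. -/

import Mathlib

open MeasureTheory

/-- Rising factorial `(y)_(k) = y (y+1) ⋯ (y+k-1)`. -/
noncomputable def risingFactorial (y : ℝ) (k : ℕ) : ℝ := ∏ i ∈ Finset.range k, (y + i)

/-- Partial-wave coefficient `B^a_{n,j}(r,μ,D)` of the hypergeometric amplitude,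
normalized up to an inessential positive constant depending only on `j` and `D`. -/
noncomputable def B (a n j : ℕ) (r μ D : ℝ) : ℝ :=
  (1 / risingFactorial (r + 1) n) *
    ∫ x in (-1:ℝ)..1,
      (1 - x ^ 2) ^ ((D - 4) / 2 + (j : ℝ)) *
        iteratedDeriv j
          (fun y : ℝ =>
            risingFactorial (((n : ℝ) - 3 * μ) * y / 2 + (μ - (n : ℝ)) / 2 + r + 1) (n - 1 + a)) x

open Polynomial in
/-- The Gegenbauer differential operator `(x² - 1) d²/dx² + (2α + 2) x d/dx`. -/
noncomputable def gegenbauerOp (α : ℝ) (G : ℝ[X]) : ℝ[X] :=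
  (X ^ 2 - 1) * derivative (derivative G) + C (2 * α + 2) * X * derivative G

open Polynomial in
/-- The cone generated by the eigenfunctions of the Gegenbauer operator with nonnegative eigenvalue
that are nonnegative and nondecreasing on `[1, ∞)`. -/
noncomputable def gegenbauerCone (α : ℝ) : AddSubmonoid ℝ[X] :=
  AddSubmonoid.closure {G | (∃ l : ℝ, 0 ≤ l ∧ gegenbauerOp α G = C l * G) ∧
    ∀ x : ℝ, 1 ≤ x → 0 ≤ G.eval x ∧ 0 ≤ (derivative G).eval x}

open Polynomial in
theorem eval_nonneg_of_mem_gegenbauerCone {α : ℝ} {P : ℝ[X]} (hP : P ∈ gegenbauerCone α)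
    {x : ℝ} (hx : 1 ≤ x) : 0 ≤ P.eval x := by
  induction hP using AddSubmonoid.closure_induction with
  | mem G hG => exact (hG.2 x hx).1
  | zero => simp
  | add F G _ _ hF hG => rw [eval_add]; exact add_nonneg hF hG

open Polynomial in
theorem C_mem_gegenbauerCone (α : ℝ) {b : ℝ} (hb : 0 ≤ b) : C b ∈ gegenbauerCone α :=
  AddSubmonoid.subset_closure ⟨⟨0, le_rfl, by simp [gegenbauerOp]⟩, fun x _ => by simp [hb]⟩

open Polynomial in
theorem intervalIntegrable_weight_mul_eval {α : ℝ} (hα : 0 ≤ α) (P : ℝ[X]) :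
    IntervalIntegrable (fun x : ℝ => (1 - x ^ 2) ^ α * P.eval x) volume (-1) 1 := by
  apply Continuous.intervalIntegrable
  exact ((by fun_prop : Continuous fun x : ℝ => 1 - x ^ 2).rpow_const
    fun _ => Or.inr hα).mul P.continuous

theorem integral_weight_pos {α : ℝ} (hα : 0 ≤ α) :
    0 < ∫ x in (-1 : ℝ)..1, (1 - x ^ 2) ^ α := by
  apply intervalIntegral.intervalIntegral_pos_of_pos_on
  · simpa using intervalIntegrable_weight_mul_eval hα 1
  · intro x hx
    exact Real.rpow_pos_of_pos (by nlinarith [hx.1, hx.2]) _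
  · norm_num

open Polynomial in
theorem integral_weight_mul_gegenbauer_primitive {α : ℝ} (hα : 0 ≤ α) (H : ℝ[X]) :
    ∫ x in (-1 : ℝ)..1, (1 - x ^ 2) ^ α *
      ((X ^ 2 - 1) * derivative H + C (2 * α + 2) * X * H).eval x = 0 := by
  have hderiv : ∀ x ∈ Set.uIcc (-1 : ℝ) 1,
      HasDerivAt (fun y : ℝ => -((1 - y ^ 2) ^ (α + 1) * H.eval y))
        ((1 - x ^ 2) ^ α * ((X ^ 2 - 1) * derivative H + C (2 * α + 2) * X * H).eval x) x := by
    intro x hx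
    rw [Set.uIcc_of_le (by norm_num)] at hx
    have hbase : HasDerivAt (fun y : ℝ => 1 - y ^ 2) (-(2 * x)) x := by
      simpa using (hasDerivAt_pow 2 x).const_sub 1
    have hw := hbase.rpow_const (p := α + 1) (Or.inr (by linarith))
    refine (hw.mul (H.hasDerivAt x)).neg.congr_deriv ?_
    rw [Real.rpow_add_one' (by nlinarith [hx.1, hx.2]) (by linarith), add_sub_cancel_right]
    simp only [eval_add, eval_mul, eval_sub, eval_pow, eval_X, eval_one, eval_C]
    ring
  rw [intervalIntegral.integral_eq_sub_of_hasDerivAt hderiv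
    (intervalIntegrable_weight_mul_eval hα _)]
  simp [Real.zero_rpow (by linarith : α + 1 ≠ 0)]

open Polynomial in
theorem exists_primitive_mem_gegenbauerCone {α : ℝ} (hα : 0 ≤ α) {Q : ℝ[X]}
    (hQ : Q ∈ gegenbauerCone (α + 1)) :
    ∃ G ∈ gegenbauerCone α, derivative G = Q ∧
      ∫ x in (-1 : ℝ)..1, (1 - x ^ 2) ^ α * G.eval x = 0 := by
  induction hQ using AddSubmonoid.closure_induction with
  | mem H hH =>
    obtain ⟨⟨l, hl, hop⟩, hpos⟩ := hH
    have hne : l + (2 * α + 2) ≠ 0 := by positivity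
    set K : ℝ[X] := (X ^ 2 - 1) * derivative H + C (2 * α + 2) * X * H with hK
    have hdK : derivative K = C (l + (2 * α + 2)) * H := by
      have h2 : (C (2 * (α + 1) + 2) : ℝ[X]) = C (2 * α + 2) + 2 := by
        rw [← C_ofNat, ← C_add]; congr 1; ring
      rw [gegenbauerOp, h2] at hop
      rw [C_add, add_mul, ← hop, hK]
      simp only [derivative_add, derivative_mul, derivative_sub, derivative_X_pow, derivative_one,
        derivative_C, derivative_X]
      simp only [Nat.cast_ofNat, C_ofNat]
      ring
    have hdG : derivative (C (l + (2 * α + 2))⁻¹ * K) = H := by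
      rw [derivative_C_mul, hdK, ← mul_assoc, ← C_mul, inv_mul_cancel₀ hne, C_1, one_mul]
    refine ⟨C (l + (2 * α + 2))⁻¹ * K, AddSubmonoid.subset_closure
      ⟨⟨l + (2 * α + 2), by positivity, ?_⟩, fun x hx => ⟨?_, ?_⟩⟩, hdG, ?_⟩
    · rw [gegenbauerOp, hdG, ← mul_assoc, ← C_mul, mul_inv_cancel₀ hne, C_1, one_mul]
    · obtain ⟨h0, h1⟩ := hpos x hx
      have hx2 : 0 ≤ x ^ 2 - 1 := by nlinarith
      simp only [hK, eval_add, eval_mul, eval_sub, eval_pow, eval_X, eval_one, eval_C]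
      positivity
    · rw [hdG]; exact (hpos x hx).1
    · simp_rw [eval_C_mul, mul_left_comm _ (l + (2 * α + 2))⁻¹]
      rw [intervalIntegral.integral_const_mul, integral_weight_mul_gegenbauer_primitive hα, mul_zero]
  | zero => exact ⟨0, zero_mem _, by simp, by simp⟩
  | add F G _ _ hF hG =>
    obtain ⟨F', hF', hdF, hiF⟩ := hF
    obtain ⟨G', hG', hdG, hiG⟩ := hG
    refine ⟨F' + G', add_mem hF' hG', by rw [derivative_add, hdF, hdG], ?_⟩
    simp_rw [eval_add, mul_add]
    rw [intervalIntegral.integral_add (intervalIntegrable_weight_mul_eval hα _)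
      (intervalIntegrable_weight_mul_eval hα _), hiF, hiG, add_zero]

open Polynomial in
theorem add_C_mem_gegenbauerCone {α : ℝ} (hα : 0 ≤ α) {G : ℝ[X]} {b : ℝ}
    (hG : G ∈ gegenbauerCone α) (hG0 : ∫ x in (-1 : ℝ)..1, (1 - x ^ 2) ^ α * G.eval x = 0)
    (h : 0 ≤ ∫ x in (-1 : ℝ)..1, (1 - x ^ 2) ^ α * (G + C b).eval x) :
    G + C b ∈ gegenbauerCone α := by
  refine add_mem hG (C_mem_gegenbauerCone α ?_)
  simp_rw [eval_add, mul_add] at h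
  rw [intervalIntegral.integral_add (intervalIntegrable_weight_mul_eval hα _)
    (intervalIntegrable_weight_mul_eval hα _), hG0, zero_add] at h
  simp_rw [eval_C] at h
  rw [intervalIntegral.integral_mul_const] at h
  exact nonneg_of_mul_nonneg_right h (integral_weight_pos hα)

open Polynomial in
/-- A polynomial with nonnegative partial-wave coefficients lies in the Gegenbauer cone. -/
theorem mem_gegenbauerCone_of_integral_nonneg (N : ℕ) {α : ℝ} (hα : 0 ≤ α) {P : ℝ[X]}
    (hdeg : P.natDegree ≤ N)
    (h : ∀ j ≤ N, 0 ≤ ∫ x in (-1 : ℝ)..1,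
      (1 - x ^ 2) ^ (α + (j : ℝ)) * (derivative^[j] P).eval x) :
    P ∈ gegenbauerCone α := by
  induction N generalizing α P with
  | zero =>
    have h0 := h 0 le_rfl
    simp only [Nat.cast_zero, add_zero, Function.iterate_zero, id_eq] at h0
    rw [eq_C_of_natDegree_le_zero hdeg, ← zero_add (C _)] at h0 ⊢
    exact add_C_mem_gegenbauerCone hα (zero_mem _) (by simp) h0
  | succ N ih =>
    have hP' : derivative P ∈ gegenbauerCone (α + 1) := by
      refine ih (by linarith) ((natDegree_derivative_le P).trans (by omega)) fun j hj => ?_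
      have := h (j + 1) (by omega)
      rw [Function.iterate_succ_apply] at this
      push_cast at this
      rwa [show α + 1 + (j : ℝ) = α + ((j : ℝ) + 1) by ring]
    obtain ⟨G, hG, hdG, hG0⟩ := exists_primitive_mem_gegenbauerCone hα hP'
    have h0 := h 0 (by omega)
    simp only [Nat.cast_zero, add_zero, Function.iterate_zero, id_eq] at h0
    have hconst : P - G = C ((P - G).coeff 0) :=
      eq_C_of_derivative_eq_zero (by rw [derivative_sub, hdG, sub_self])
    have hPG : P = G + C ((P - G).coeff 0) := by rw [← hconst]; ring
    rw [hPG] at h0 ⊢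
    exact add_C_mem_gegenbauerCone hα hG hG0 h0

theorem risingFactorial_pos {y : ℝ} (hy : 0 < y) (k : ℕ) : 0 < risingFactorial y k :=
  Finset.prod_pos fun _ _ => by positivity

theorem risingFactorial_neg {y : ℝ} (hy : y < 0) (hy1 : -1 < y) {k : ℕ} (hk : k ≠ 0) :
    risingFactorial y k < 0 := by
  obtain ⟨m, rfl⟩ := Nat.exists_eq_succ_of_ne_zero hk
  rw [risingFactorial, Finset.prod_range_succ', Nat.cast_zero, add_zero]
  refine mul_neg_of_pos_of_neg (Finset.prod_pos fun i _ => ?_) hy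
  have : (0 : ℝ) ≤ i := i.cast_nonneg
  push_cast
  linarith

open Polynomial in
/-- The polynomial `x ↦ (c x + e)_(N)`. -/
noncomputable def risingPoly (c e : ℝ) (N : ℕ) : ℝ[X] :=
  ∏ i ∈ Finset.range N, (C c * X + C (e + i))

theorem eval_risingPoly (c e : ℝ) (N : ℕ) (x : ℝ) :
    (risingPoly c e N).eval x = risingFactorial (c * x + e) N := by
  simp [risingPoly, risingFactorial, Polynomial.eval_prod, add_assoc]

theorem natDegree_risingPoly_le (c e : ℝ) (N : ℕ) : (risingPoly c e N).natDegree ≤ N := by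
  refine (Polynomial.natDegree_prod_le _ _).trans ?_
  refine (Finset.sum_le_sum fun i _ => Polynomial.natDegree_linear_le).trans ?_
  simp

open Polynomial in
theorem iteratedDeriv_polynomial_eval (P : ℝ[X]) (j : ℕ) :
    iteratedDeriv j (fun x => P.eval x) = fun x => (derivative^[j] P).eval x := by
  induction j with
  | zero => simp
  | succ j ih =>
    rw [iteratedDeriv_succ, ih, Function.iterate_succ_apply']
    exact funext fun x => Polynomial.deriv _

/-- Theorem 2: non-unitarity for large mass gap. -/
theorem non_unitarity_theorem2 (a : ℕ) (ha : a = 0 ∨ a = 1) (D : ℝ) (hD : 4 ≤ D)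
    (r μ : ℝ) (hr : -1 < r ∨ ∀ m : ℤ, (m : ℝ) ≠ r)
    (hμ : r + 1 < μ) (hodd : Odd ⌈6 * μ⌉) :
    ∃ n j : ℕ, 1 ≤ n ∧ 3 * μ ≤ (n : ℝ) ∧ j ≤ n - 1 + a ∧ B a n j r μ D < 0 := by
  obtain ⟨n, hn⟩ := exists_nat_gt (max 1 (3 * μ))
  obtain ⟨hn1, hnμ⟩ := max_lt_iff.mp hn
  have hn1 : 1 < n := by exact_mod_cast hn1
  by_contra! hB
  have hnorm : risingFactorial (r + 1) n ≠ 0 := by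
    refine Finset.prod_ne_zero_iff.mpr fun i _ hi => ?_
    rcases hr with hr | hr
    · have : (0 : ℝ) ≤ i := i.cast_nonneg
      linarith
    · apply hr (-(1 + i))
      push_cast
      linarith
  set c : ℝ := ((n : ℝ) - 3 * μ) / 2 with hc
  set e : ℝ := (μ - (n : ℝ)) / 2 + r + 1 with he
  have hcpos : 0 < c := by rw [hc]; linarith
  have hce : c + e < 0 := by rw [hc, he]; linarith
  set N := n - 1 + a
  have hα : 0 ≤ (D - 4) / 2 := by linarith
  have hcoeff : ∀ j ≤ N, 0 ≤ 1 / risingFactorial (r + 1) n * ∫ x in (-1 : ℝ)..1,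
      (1 - x ^ 2) ^ ((D - 4) / 2 + (j : ℝ)) *
        (Polynomial.derivative^[j] (risingPoly c e N)).eval x := by
    intro j hj
    have := hB n j (by omega) hnμ.le hj
    rw [B] at this
    rw [show (fun y : ℝ => risingFactorial (((n : ℝ) - 3 * μ) * y / 2 + (μ - (n : ℝ)) / 2 + r + 1)
        (n - 1 + a)) = fun y => (risingPoly c e N).eval y from funext fun y => by
          rw [eval_risingPoly]; congr 1; rw [hc, he]; ring,
      iteratedDeriv_polynomial_eval] at this
    exact this
  have hmem : Polynomial.C (1 / risingFactorial (r + 1) n) * risingPoly c e N ∈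
      gegenbauerCone ((D - 4) / 2) := by
    refine mem_gegenbauerCone_of_integral_nonneg N hα
      ((Polynomial.natDegree_C_mul_le _ _).trans (natDegree_risingPoly_le c e N)) fun j hj => ?_
    simp_rw [Polynomial.iterate_derivative_C_mul, Polynomial.eval_C_mul, mul_left_comm _ (1 / risingFactorial (r + 1) n)]
    rw [intervalIntegral.integral_const_mul]
    exact hcoeff j hj
  have hval : ∀ y : ℝ, c + e ≤ y →
      0 ≤ 1 / risingFactorial (r + 1) n * risingFactorial y N := by
    intro y hy
    have := eval_nonneg_of_mem_gegenbauerCone hmem (x := (y - e) / c)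
      ((one_le_div hcpos).mpr (by linarith))
    rwa [Polynomial.eval_C_mul, eval_risingPoly, mul_div_cancel₀ _ hcpos.ne',
      sub_add_cancel] at this
  have hpos := hval 1 (by linarith)
  have hneg := hval (max (c + e) (-1 / 2)) (le_max_left _ _)
  have h1 := risingFactorial_pos one_pos N
  have h2 : risingFactorial (max (c + e) (-1 / 2)) N < 0 :=
    risingFactorial_neg (max_lt hce (by norm_num)) (lt_max_of_lt_right (by norm_num)) (by omega)
  have h3 : 1 / risingFactorial (r + 1) n ≠ 0 := one_div_ne_zero hnorm
  rcases h3.lt_or_gt with h3 | h3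
  · exact absurd hpos (not_le.mpr (mul_neg_of_neg_of_pos h3 h1))
  · exact absurd hneg (not_le.mpr (mul_neg_of_pos_of_neg h3 h2))
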